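/- For every n ≥ 12 and every k with 2 ≤ k ≤ (n−5)(n−6)(n−7)/4, the direct power (A_n)^k of the alternating group A_n is a Beauville group. -/

import Mathlib

/-- The set of elements of `G` conjugate to a power of `a`, `b` or `c`. -/
def SigmaSet {G : Type*} [Group G] (a b c : G) : Set G :=
  {g | ∃ d ∈ ({a, b, c} : Set G), ∃ m : ℤ, IsConj (d ^ m) g}

/-- `G` is an (unmixed) Beauville group. -/
def IsBeauvilleGroup (G : Type*) [Group G] : Prop :=
  ∃ a₁ b₁ c₁ a₂ b₂ c₂ : G,
    (Subgroup.closure {a₁, b₁, c₁} = ⊤ ∧ a₁ * b₁ * c₁ = 1 ∧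
      (1 : ℚ) / (orderOf a₁) + 1 / (orderOf b₁) + 1 / (orderOf c₁) < 1) ∧
    (Subgroup.closure {a₂, b₂, c₂} = ⊤ ∧ a₂ * b₂ * c₂ = 1 ∧
      (1 : ℚ) / (orderOf a₂) + 1 / (orderOf b₂) + 1 / (orderOf c₂) < 1) ∧
    SigmaSet a₁ b₁ c₁ ∩ SigmaSet a₂ b₂ c₂ = {1}


/-- If `x` and a common power `t` of all the distinct elements `y i` generate a perfect simple
group `S`, then the constant family `x` together with `y` generates the direct power of `S`. -/
theorem pi_eq_top_of_const_mem {ι S : Type*} [Finite ι] [Group S] [IsSimpleGroup S]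
    (hS : commutator S = ⊤) {x t : S} {y : ι → S} (hy : Function.Injective y) {e : ℕ}
    (hyt : ∀ i, y i ^ e = t) (hxt : Subgroup.closure {x, t} = ⊤) {H : Subgroup (ι → S)}
    (hx : (fun _ => x) ∈ H) (hyH : y ∈ H) : H = ⊤ := by
  classical
  have hconst : ∀ s : S, (fun _ => s) ∈ H := by
    intro s
    have hle : Subgroup.closure {x, t} ≤ H.comap (Pi.constMonoidHom ι S) := by
      rw [Subgroup.closure_le]
      rintro s (rfl | rfl)
      · exact hx
      · have : (fun _ => s) = y ^ e := by ext i; simp [hyt]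
        change (fun _ => s) ∈ H
        exact this ▸ H.pow_mem hyH e
    exact hle (hxt ▸ Subgroup.mem_top s)
  have hpair : ∀ i j, i ≠ j → ∀ s, ∃ h ∈ H, h i = s ∧ h j = 1 := by
    intro i j hij
    let N : Subgroup S := (H ⊓ (Pi.evalMonoidHom (fun _ : ι => S) j).ker).map
      (Pi.evalMonoidHom (fun _ : ι => S) i)
    have hN : N.Normal := by
      refine ⟨?_⟩
      rintro _ ⟨h, ⟨hH, hj⟩, rfl⟩ g
      refine ⟨(fun _ => g) * h * (fun _ => g)⁻¹,
        ⟨H.mul_mem (H.mul_mem (hconst g) hH) (H.inv_mem (hconst g)), ?_⟩, rfl⟩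
      have : h j = 1 := hj
      simp [this]
    have hne : N ≠ ⊥ := by
      intro hbot
      have hmem : y i * (y j)⁻¹ ∈ N :=
        ⟨y * (fun _ => y j)⁻¹, ⟨H.mul_mem hyH (H.inv_mem (hconst _)), by simp⟩, rfl⟩
      rw [hbot, Subgroup.mem_bot, mul_inv_eq_one] at hmem
      exact hij (hy hmem)
    have htop : N = ⊤ := hN.eq_bot_or_eq_top.resolve_left hne
    intro s
    obtain ⟨h, ⟨hH, hj⟩, hs⟩ : s ∈ N := htop ▸ Subgroup.mem_top s
    exact ⟨h, hH, hs, hj⟩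
  have hfin : ∀ i, ∀ J : Finset ι, i ∉ J → ∀ s, ∃ h ∈ H, h i = s ∧ ∀ j ∈ J, h j = 1 := by
    intro i J
    induction J using Finset.induction with
    | empty => exact fun _ s => ⟨fun _ => s, hconst s, rfl, by simp⟩
    | insert j J hj ih =>
      intro hi s
      simp only [Finset.mem_insert, not_or] at hi
      let N : Subgroup S := (H ⊓ Subgroup.pi (insert j J : Finset ι) fun _ => ⊥).map
        (Pi.evalMonoidHom (fun _ : ι => S) i)
      have hN : commutator S ≤ N := by
        rw [commutator_def, Subgroup.commutator_le]
        intro p _ q _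
        obtain ⟨f, hf, hfi, hfj⟩ := hpair i j hi.1 p
        obtain ⟨g, hg, hgi, hgJ⟩ := ih hi.2 q
        refine ⟨f * g * f⁻¹ * g⁻¹,
          ⟨H.mul_mem (H.mul_mem (H.mul_mem hf hg) (H.inv_mem hf)) (H.inv_mem hg), ?_⟩, ?_⟩
        · intro j' hj'
          rcases Finset.mem_insert.1 hj' with rfl | hj'
          · simp [hfj]
          · simp [hgJ j' hj']
        · simp [commutatorElement_def, hfi, hgi]
      obtain ⟨h, ⟨hH, hJ⟩, hs⟩ : s ∈ N := hN (hS ▸ Subgroup.mem_top s)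
      exact ⟨h, hH, hs, fun j' hj' => Subgroup.mem_bot.1 (hJ j' hj')⟩
  cases nonempty_fintype ι
  refine eq_top_iff.2 fun f _ => Subgroup.pi_mem_of_mulSingle_mem f fun i => ?_
  obtain ⟨h, hH, hi, hJ⟩ := hfin i (Finset.univ.erase i) (by simp) (f i)
  convert! hH
  ext j
  by_cases hij : j = i
  · subst hij; simp [hi]
  · rw [Pi.mulSingle_eq_of_ne hij, hJ j (by simp [hij])]
open Equiv

/-- A permutation of order `M` all of whose nontrivial powers move at least `M` points. -/
structure IsLongPerm {α : Type*} [Fintype α] [DecidableEq α] (M : ℕ) (σ : Perm α) : Prop where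
  orderOf_eq : orderOf σ = M
  le_card_support : ∀ m : ℤ, σ ^ m ≠ 1 → M ≤ (σ ^ m).support.card

theorem IsLongPerm.inv {α : Type*} [Fintype α] [DecidableEq α] {M : ℕ} {σ : Perm α}
    (h : IsLongPerm M σ) : IsLongPerm M σ⁻¹ :=
  ⟨by rw [orderOf_inv, h.orderOf_eq], fun m hm => by
    rw [inv_zpow'] at hm ⊢
    exact h.le_card_support _ hm⟩

/-- A family of generating triples `(x, y i, (x * y i)⁻¹)` of an alternating group which together
generate the direct power, where the first and the last entries are long permutations and all
powers of prime order of the middle entries move `p` or `r` points. -/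
structure IsTripleFamily {α ι : Type*} [Fintype α] [DecidableEq α] (M p r : ℕ)
    (x : alternatingGroup α) (y : ι → alternatingGroup α) : Prop where
  closure_eq_top : Subgroup.closure {(fun _ => x), y, ((fun _ => x) * y)⁻¹} = ⊤
  isLongPerm_left : IsLongPerm M (x : Perm α)
  isLongPerm_mul : ∀ i, IsLongPerm M ((x * y i : alternatingGroup α) : Perm α)
  le_orderOf : ∀ i, 4 ≤ orderOf (y i)
  card_support : ∀ i, ∀ m : ℤ, (orderOf ((y i : Perm α) ^ m)).Prime →
    ((y i : Perm α) ^ m).support.card = p ∨ ((y i : Perm α) ^ m).support.card = r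

theorem one_div_add_one_div_add_one_div_lt_one {a b c : ℕ} (ha : 4 ≤ a) (hb : 4 ≤ b)
    (hc : 4 ≤ c) : (1 : ℚ) / a + 1 / b + 1 / c < 1 := by
  have key : ∀ m : ℕ, 4 ≤ m → (1 : ℚ) / m ≤ 1 / 4 := fun m hm =>
    one_div_le_one_div_of_le (by norm_num) (by exact_mod_cast hm)
  linarith [key a ha, key b hb, key c hc]

theorem orderOf_apply_le_orderOf {ι G : Type*} [Finite ι] [Group G] [Finite G] (f : ι → G)
    (i : ι) : orderOf (f i) ≤ orderOf f :=
  Nat.le_of_dvd (orderOf_pos f) (orderOf_map_dvd (Pi.evalMonoidHom (fun _ : ι => G) i) f)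

namespace IsTripleFamily

variable {α ι : Type*} [Fintype α] [DecidableEq α] {M p r : ℕ}
  {x : alternatingGroup α} {y : ι → alternatingGroup α}

theorem sum_one_div_orderOf_lt_one [Finite ι] [Nonempty ι] (h : IsTripleFamily M p r x y)
    (hM : 4 ≤ M) :
    (1 : ℚ) / orderOf (fun _ : ι => x) + 1 / orderOf y +
      1 / orderOf ((fun _ : ι => x) * y)⁻¹ < 1 := by
  obtain ⟨i⟩ := ‹Nonempty ι›
  have hx := h.isLongPerm_left.orderOf_eq
  have hxy := (h.isLongPerm_mul i).orderOf_eq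
  rw [Subgroup.orderOf_coe] at hx
  rw [Subgroup.orderOf_coe] at hxy
  refine one_div_add_one_div_add_one_div_lt_one ?_ ?_ ?_
  · exact (hM.trans_eq hx.symm).trans (orderOf_apply_le_orderOf (fun _ : ι => x) i)
  · exact (h.le_orderOf i).trans (orderOf_apply_le_orderOf y i)
  · rw [orderOf_inv]
    exact (hM.trans_eq hxy.symm).trans (orderOf_apply_le_orderOf ((fun _ : ι => x) * y) i)

theorem dvd_or_card_support (h : IsTripleFamily M p r x y) {g : ι → alternatingGroup α}
    (hg : g ∈ SigmaSet (fun _ => x) y ((fun _ => x) * y)⁻¹) (i : ι) (m : ℕ)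
    (hq : (orderOf ((g i : Perm α) ^ m)).Prime) :
    orderOf ((g i : Perm α) ^ m) ∣ M ∧ M ≤ ((g i : Perm α) ^ m).support.card ∨
      ((g i : Perm α) ^ m).support.card = p ∨ ((g i : Perm α) ^ m).support.card = r := by
  obtain ⟨d, hd, l, hconj⟩ := hg
  obtain ⟨c, hc⟩ := isConj_iff.1 hconj
  have hgi : (g i : Perm α) ^ m = c i * (d i : Perm α) ^ (l * m) * (c i : Perm α)⁻¹ := by
    rw [← hc]
    simp [zpow_mul, ← conj_pow]
  have hord : orderOf ((d i : Perm α) ^ (l * m)) = orderOf ((g i : Perm α) ^ m) := by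
    rw [hgi, ← MulAut.conj_apply, MulEquiv.orderOf_eq]
  have hcard : ((d i : Perm α) ^ (l * m)).support.card = ((g i : Perm α) ^ m).support.card := by
    rw [hgi, Perm.card_support_conj]
  rw [← hord] at hq ⊢
  rw [← hcard]
  have long : ∀ {σ : Perm α}, IsLongPerm M σ → (orderOf (σ ^ (l * m : ℤ))).Prime →
      orderOf (σ ^ (l * m : ℤ)) ∣ M ∧ M ≤ (σ ^ (l * m : ℤ)).support.card := by
    intro σ hσ hq
    refine ⟨?_, hσ.le_card_support _ fun h1 => ?_⟩
    · rw [← hσ.orderOf_eq]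
      exact orderOf_dvd_of_mem_zpowers ⟨_, rfl⟩
    · rw [h1, orderOf_one] at hq
      exact Nat.not_prime_one hq
  rcases hd with rfl | rfl | rfl
  · exact Or.inl (long h.isLongPerm_left hq)
  · exact Or.inr (h.card_support i _ hq)
  · exact Or.inl (long (h.isLongPerm_mul i).inv hq)

end IsTripleFamily

theorem isBeauvilleGroup_of_isTripleFamily {α ι : Type*} [Fintype α] [DecidableEq α] [Finite ι]
    [Nonempty ι] {M₁ M₂ p₁ p₂ r₁ r₂ : ℕ} {x₁ x₂ : alternatingGroup α}
    {y₁ y₂ : ι → alternatingGroup α} (h₁ : IsTripleFamily M₁ p₁ r₁ x₁ y₁)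
    (h₂ : IsTripleFamily M₂ p₂ r₂ x₂ y₂) (hM : M₁.Coprime M₂) (hM₁ : 4 ≤ M₁) (hM₂ : 4 ≤ M₂)
    (hp₁ : p₁ < M₂) (hr₁ : r₁ < M₂) (hp₂ : p₂ < M₁) (hr₂ : r₂ < M₁)
    (hpr : Disjoint ({p₁, r₁} : Finset ℕ) {p₂, r₂}) :
    IsBeauvilleGroup (ι → alternatingGroup α) := by
  refine ⟨fun _ => x₁, y₁, ((fun _ => x₁) * y₁)⁻¹, fun _ => x₂, y₂, ((fun _ => x₂) * y₂)⁻¹,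
    ⟨h₁.closure_eq_top, mul_inv_cancel _, h₁.sum_one_div_orderOf_lt_one hM₁⟩,
    ⟨h₂.closure_eq_top, mul_inv_cancel _, h₂.sum_one_div_orderOf_lt_one hM₂⟩, ?_⟩
  refine Set.eq_singleton_iff_unique_mem.2 ⟨⟨?_, ?_⟩, ?_⟩
  · exact ⟨_, Or.inl rfl, 0, by simp⟩
  · exact ⟨_, Or.inl rfl, 0, by simp⟩
  rintro g ⟨hg₁, hg₂⟩
  by_contra hne
  obtain ⟨i, hi⟩ := Function.ne_iff.1 hne
  have hi' : orderOf (g i : Perm α) ≠ 1 := by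
    rw [Ne, orderOf_eq_one_iff]
    exact fun h => hi (Subtype.ext h)
  obtain ⟨q, hq, m, hm⟩ := Nat.exists_prime_and_dvd hi'
  have hord : orderOf ((g i : Perm α) ^ m) = q := by
    have hpos := orderOf_pos (g i : Perm α)
    have hm0 : m ≠ 0 := by rintro rfl; omega
    rw [orderOf_pow_of_dvd hm0 ⟨q, by rw [hm, mul_comm]⟩, hm,
      Nat.mul_div_cancel _ (Nat.pos_of_ne_zero hm0)]
  have e₁ := h₁.dvd_or_card_support hg₁ i m (by rwa [hord])
  have e₂ := h₂.dvd_or_card_support hg₂ i m (by rwa [hord])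
  rw [hord] at e₁ e₂
  rcases e₁ with ⟨d₁, l₁⟩ | e₁ <;> rcases e₂ with ⟨d₂, l₂⟩ | e₂
  · exact hq.one_lt.ne' (Nat.dvd_one.1 (hM ▸ Nat.dvd_gcd d₁ d₂))
  · omega
  · omega
  · exact Finset.disjoint_left.1 hpr (by simpa using e₁) (by simpa using e₂)

theorem IsLongPerm.of_isCycleOn {α : Type*} [Fintype α] [DecidableEq α] {M : ℕ} {σ : Perm α}
    {s : Finset α} (hs : σ.IsCycleOn s) (hne : s.Nonempty) (hM : s.card = M)
    (hfix : ∀ a ∉ s, (σ ^ M) a = a) : IsLongPerm M σ := by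
  have hpow : σ ^ M = 1 := by
    ext a
    by_cases ha : a ∈ s
    · rw [← hM, hs.pow_card_apply ha, Perm.one_apply]
    · rw [hfix a ha, Perm.one_apply]
  obtain ⟨a, ha⟩ := hne
  refine ⟨Nat.dvd_antisymm (orderOf_dvd_of_pow_eq_one hpow) ?_, fun m hm => ?_⟩
  · rw [← hM, ← hs.pow_apply_eq ha, pow_orderOf_eq_one, Perm.one_apply]
  · rw [← hM]
    refine Finset.card_le_card fun b hb => Perm.mem_support.2 fun h => hm ?_
    rw [hs.zpow_apply_eq hb, hM] at h
    obtain ⟨c, rfl⟩ := h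
    rw [zpow_mul, zpow_natCast, hpow, one_zpow]

/-- Multiplying a cycle `e 0 ↦ e 1 ↦ ⋯ ↦ e M = e 0` by a permutation `w` of some points
`e (g 0), …, e (g r)` on it gives a cycle again if, up to relabelling, `w` composed with the cyclic
rotation of these points is a cycle. -/
theorem isCycleOn_mul_of_arcs {α : Type*} [DecidableEq α] {σ w : Perm α} {M r : ℕ} {e : ℕ → α}
    (he : ∀ i < M, σ (e i) = e (i + 1)) (heM : e M = e 0) {g : Fin (r + 1) → ℕ}
    (hg : StrictMono g) (hgM : ∀ k, g k < M) {ω : Perm (Fin (r + 1))}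
    (hω : ∀ k, ∃ m : ℕ, ((finRotate (r + 1) * ω) ^ m) 0 = k)
    (hw : ∀ k, w (e (g k)) = e (g (ω k))) (hw' : ∀ i < M, (∀ k, g k ≠ i) → w (e i) = e i) :
    (σ * w).IsCycleOn ((Finset.range M).image e : Finset α) := by
  have hstep : ∀ i < M, (∀ k, g k ≠ i) → (σ * w).SameCycle (e i) (e (i + 1)) := fun i hi hk =>
    ⟨1, by rw [zpow_one, Perm.mul_apply, hw' i hi hk, he i hi]⟩
  have hjump : ∀ k, (σ * w) (e (g k)) = e (g (ω k) + 1) := fun k => by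
    rw [Perm.mul_apply, hw, he _ (hgM _)]
  have harc : ∀ k, ∀ d i, i + d = g k → (∀ j < k, g j < i) →
      (σ * w).SameCycle (e i) (e (g k)) := by
    intro k d
    induction d with
    | zero =>
      rintro i hi -
      rw [← hi, add_zero]
    | succ d ih =>
      intro i hi hj
      refine (hstep i (by have := hgM k; omega) fun j hji => ?_).trans
        (ih (i + 1) (by omega) fun j hjk => (hj j hjk).trans (Nat.lt_succ_self i))
      rcases lt_or_ge j k with h | h
      · exact (hj j h).ne hji
      · have := hg.monotone h
        omega
  have harc₀ : (σ * w).SameCycle (e 0) (e (g 0)) :=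
    harc 0 (g 0) 0 (by omega) fun j hj => absurd hj (Fin.not_lt_zero j)
  have hlast : ∀ d i, i + d = M → (∀ j, g j < i) → (σ * w).SameCycle (e i) (e (g 0)) := by
    intro d
    induction d with
    | zero =>
      rintro i hi -
      rwa [← add_zero i, hi, heM]
    | succ d ih =>
      intro i hi hj
      exact (hstep i (by omega) fun j => (hj j).ne).trans
        (ih (i + 1) (by omega) fun j => (hj j).trans (Nat.lt_succ_self i))
  have hrot : ∀ k, (σ * w).SameCycle (e (g k + 1)) (e (g (finRotate (r + 1) k))) := by
    intro k
    have hk : g k + 1 ≤ M := hgM k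
    induction k using Fin.lastCases with
    | last =>
      rw [finRotate_last]
      exact hlast (M - (g (Fin.last r) + 1)) _ (by omega) fun j =>
        Nat.lt_succ_of_le (hg.monotone (Fin.le_last j))
    | cast k =>
      have hlt : g k.castSucc < g k.succ := hg (Fin.castSucc_lt_succ)
      rw [finRotate_apply, Fin.coeSucc_eq_succ]
      refine harc _ (g k.succ - (g k.castSucc + 1)) _ (by omega) fun j hj =>
        Nat.lt_succ_of_le (hg.monotone ?_)
      rw [Fin.le_def]
      rw [Fin.lt_def, Fin.val_succ] at hj
      exact Nat.lt_succ_iff.1 hj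
  have hsel : ∀ m : ℕ, (σ * w).SameCycle (e (g (((finRotate (r + 1) * ω) ^ m) 0))) (e (g 0)) := by
    intro m
    induction m with
    | zero => rfl
    | succ m ih =>
      rw [pow_succ', Perm.mul_apply, Perm.mul_apply]
      refine (hrot _).symm.trans ?_
      rw [← hjump]
      exact Perm.sameCycle_apply_left.2 ih
  have hsel' : ∀ k, (σ * w).SameCycle (e (g k)) (e (g 0)) := fun k => by
    obtain ⟨m, rfl⟩ := hω k
    exact hsel m
  have hall : ∀ i < M, (σ * w).SameCycle (e i) (e (g 0)) := by
    intro i hi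
    by_cases h : ∃ k, i ≤ g k
    · obtain ⟨k, hk⟩ := h
      induction k using Fin.induction with
      | zero => exact harc 0 (g 0 - i) i (by omega) fun j hj => absurd hj (Fin.not_lt_zero j)
      | succ k ih =>
        by_cases h : i ≤ g k.castSucc
        · exact ih h
        · refine (harc k.succ (g k.succ - i) i (by omega) fun j hj => ?_).trans (hsel' _)
          refine lt_of_le_of_lt (hg.monotone ?_) (not_le.1 h)
          rw [Fin.le_def]
          rw [Fin.lt_def, Fin.val_succ] at hj
          exact Nat.lt_succ_iff.1 hj
    · exact hlast (M - i) i (by omega) fun j => not_le.1 fun hj => h ⟨j, hj⟩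
  have hM : 0 < M := (Nat.zero_le _).trans_lt (hgM 0)
  have hmem : ∀ i ≤ M, e i ∈ (Finset.range M).image e := by
    intro i hi
    rcases hi.lt_or_eq with hi | rfl
    · exact Finset.mem_image_of_mem e (Finset.mem_range.2 hi)
    · rw [heM]
      exact Finset.mem_image_of_mem e (Finset.mem_range.2 hM)
  have hmaps : Set.MapsTo (σ * w) ((Finset.range M).image e : Finset α)
      ((Finset.range M).image e : Finset α) := by
    intro a ha
    obtain ⟨i, hi, rfl⟩ := Finset.mem_image.1 ha
    rw [Finset.mem_range] at hi
    by_cases h : ∃ k, g k = i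
    · obtain ⟨k, rfl⟩ := h
      rw [hjump]
      exact hmem _ (hgM _)
    · rw [Perm.mul_apply, hw' i hi (not_exists.1 h), he i hi]
      exact hmem _ hi
  refine ⟨⟨hmaps, (σ * w).injective.injOn, ?_⟩, ?_⟩
  · exact Finset.surjOn_of_injOn_of_card_le _ hmaps (σ * w).injective.injOn le_rfl
  · intro a ha b hb
    obtain ⟨i, hi, rfl⟩ := Finset.mem_image.1 ha
    obtain ⟨j, hj, rfl⟩ := Finset.mem_image.1 hb
    exact (hall i (Finset.mem_range.1 hi)).trans (hall j (Finset.mem_range.1 hj)).symm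

section Extend

variable {α β : Type*} [Fintype α] [DecidableEq β] (f : α ↪ β)

/-- Extension of permutations along an embedding, as a group homomorphism. -/
def extendPerm : Perm α →* Perm β :=
  Perm.extendDomainHom f.toEquivRange

theorem extendPerm_apply (σ : Perm α) (a : α) : extendPerm f σ (f a) = f (σ a) :=
  Perm.viaFintypeEmbedding_apply_image σ f a

theorem extendPerm_apply_of_notMem (σ : Perm α) {b : β} (h : ∀ a, f a ≠ b) :
    extendPerm f σ b = b :=
  Perm.viaFintypeEmbedding_apply_notMem_range σ f (by simpa using h)

theorem extendPerm_injective : Function.Injective (extendPerm f) :=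
  Perm.extendDomainHom_injective _

theorem sign_extendPerm [DecidableEq α] [Fintype β] (σ : Perm α) :
    Perm.sign (extendPerm f σ) = Perm.sign σ :=
  Perm.viaFintypeEmbedding_sign σ f

theorem card_support_extendPerm [DecidableEq α] [Fintype β] (σ : Perm α) :
    (extendPerm f σ).support.card = σ.support.card :=
  Perm.card_support_extend_domain f.toEquivRange

theorem orderOf_extendPerm (σ : Perm α) : orderOf (extendPerm f σ) = orderOf σ :=
  orderOf_injective _ (extendPerm_injective f) σ

theorem isThreeCycle_extendPerm [DecidableEq α] [Fintype β] {σ : Perm α} (h : σ.IsThreeCycle) :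
    (extendPerm f σ).IsThreeCycle := by
  rw [← card_support_eq_three_iff] at h ⊢
  rw [card_support_extendPerm, h]

end Extend

theorem val_finRotate_of_lt {n : ℕ} {i : Fin (n + 1)} (h : (i : ℕ) < n) :
    (finRotate (n + 1) i : ℕ) = i + 1 :=
  coe_finRotate_of_ne_last fun hi => by simp [hi] at h

section HeadTail

variable {L N : ℕ}

/-- The embedding of the first `L + 1` points. -/
abbrev headEmb (L N : ℕ) : Fin (L + 1) ↪ Fin (L + 1 + (N + 1)) := Fin.castAddEmb (N + 1)

/-- The embedding of the last `N + 1` points. -/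
abbrev tailEmb (L N : ℕ) : Fin (N + 1) ↪ Fin (L + 1 + (N + 1)) := Fin.natAddEmb (L + 1)

theorem headEmb_ne_tailEmb (a : Fin (L + 1)) (j : Fin (N + 1)) :
    headEmb L N a ≠ tailEmb L N j := by
  intro h
  have := congrArg Fin.val h
  simp at this
  omega

theorem head_or_tail (i : Fin (L + 1 + (N + 1))) :
    (∃ a, headEmb L N a = i) ∨ ∃ j, tailEmb L N j = i := by
  induction i using Fin.addCases with
  | left a => exact Or.inl ⟨a, rfl⟩
  | right j => exact Or.inr ⟨j, rfl⟩

/-- The full rotation followed by a permutation of the first points. -/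
def turn (N : ℕ) (η : Perm (Fin (L + 1))) : Perm (Fin (L + 1 + (N + 1))) :=
  extendPerm (headEmb L N) η * finRotate _

variable (η : Perm (Fin (L + 1)))

theorem turn_head {a : Fin (L + 1)} (ha : a ≠ Fin.last L) :
    turn N η (headEmb L N a) = headEmb L N (η (a + 1)) := by
  have hlt := Fin.lt_last_iff_ne_last.2 ha
  rw [turn, Perm.mul_apply, ← extendPerm_apply]
  congr 1
  ext
  rw [Fin.lt_def] at hlt
  have h := val_finRotate_of_lt (n := L + 1 + N) (i := headEmb L N a) (by simp at hlt ⊢; omega)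
  exact h.trans (by simp [Fin.val_add_one_of_lt hlt])

theorem turn_head_last : turn N η (headEmb L N (Fin.last L)) = tailEmb L N 0 := by
  rw [turn, Perm.mul_apply]
  have : finRotate _ (headEmb L N (Fin.last L)) = tailEmb L N 0 := by
    ext
    have h := val_finRotate_of_lt (n := L + 1 + N) (i := headEmb L N (Fin.last L))
      (by simp; omega)
    exact h.trans (by simp)
  rw [this, extendPerm_apply_of_notMem _ _ fun a => headEmb_ne_tailEmb a 0]

theorem turn_tail {j : Fin (N + 1)} (hj : j ≠ Fin.last N) :
    turn N η (tailEmb L N j) = tailEmb L N (j + 1) := by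
  have hlt := Fin.lt_last_iff_ne_last.2 hj
  have : finRotate _ (tailEmb L N j) = tailEmb L N (j + 1) := by
    ext
    rw [Fin.lt_def] at hlt
    have h := val_finRotate_of_lt (n := L + 1 + N) (i := tailEmb L N j) (by simp at hlt ⊢; omega)
    exact h.trans (by simp [Fin.val_add_one_of_lt hlt]; omega)
  rw [turn, Perm.mul_apply, this, extendPerm_apply_of_notMem _ _ fun a => headEmb_ne_tailEmb a _]

theorem turn_tail_last : turn N η (tailEmb L N (Fin.last N)) = headEmb L N (η 0) := by
  have : finRotate _ (tailEmb L N (Fin.last N)) = headEmb L N 0 := by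
    have h : tailEmb L N (Fin.last N) = Fin.last _ := by ext; simp
    rw [h]
    exact finRotate_last
  rw [turn, Perm.mul_apply, this, extendPerm_apply]

theorem extendPerm_headEmb_tail (τ : Perm (Fin (L + 1))) (j : Fin (N + 1)) :
    extendPerm (headEmb L N) τ (tailEmb L N j) = tailEmb L N j :=
  extendPerm_apply_of_notMem _ _ fun a => headEmb_ne_tailEmb a j

/-- The permutation of the tail induced by a pattern `ω` on a set of selected tail points. -/
def tailPerm (L : ℕ) {N r : ℕ} (S : Fin r ↪o Fin (N + 1)) (ω : Perm (Fin r)) :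
    Perm (Fin (L + 1 + (N + 1))) :=
  extendPerm (S.toEmbedding.trans (tailEmb L N)) ω

variable {r : ℕ} (S : Fin r ↪o Fin (N + 1)) (ω : Perm (Fin r))

theorem tailPerm_selected (k : Fin r) :
    tailPerm L S ω (tailEmb L N (S k)) = tailEmb L N (S (ω k)) :=
  extendPerm_apply (S.toEmbedding.trans (tailEmb L N)) ω k

theorem tailPerm_tail {j : Fin (N + 1)} (hj : ∀ k, S k ≠ j) :
    tailPerm L S ω (tailEmb L N j) = tailEmb L N j :=
  extendPerm_apply_of_notMem _ _ fun k h => hj k ((tailEmb L N).injective h)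

theorem tailPerm_head (a : Fin (L + 1)) :
    tailPerm L S ω (headEmb L N a) = headEmb L N a :=
  extendPerm_apply_of_notMem _ _ fun k h => headEmb_ne_tailEmb a (S k) h.symm

end HeadTail

/-- The sequence `P` runs through the points of the head on the cycle of
`turn N η * extendPerm (headEmb L N) τ` containing the tail, and the remaining points of the head
are fixed or paired with each other. -/
structure IsHeadPath {L ℓ : ℕ} (η τ : Perm (Fin (L + 1))) (P : Fin (ℓ + 1) → Fin (L + 1)) :
    Prop where
  injective : Function.Injective P
  start : η 0 = P 0
  step : ∀ l : Fin ℓ, τ (P l.castSucc) ≠ Fin.last L ∧ η (τ (P l.castSucc) + 1) = P l.succ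
  finish : τ (P (Fin.last ℓ)) = Fin.last L
  rest : ∀ a, (∀ l, P l ≠ a) → τ a ≠ Fin.last L ∧ τ (η (τ a + 1)) ≠ Fin.last L ∧
    η (τ (η (τ a + 1)) + 1) = a

theorem IsHeadPath.isLongPerm {L N ℓ r : ℕ} {η τ : Perm (Fin (L + 1))}
    {P : Fin (ℓ + 1) → Fin (L + 1)} (h : IsHeadPath η τ P)
    (hfix : (∀ a, (∀ l, P l ≠ a) → η (τ a + 1) = a) ∨ Even (N + 1 + (ℓ + 1)))
    {ω : Perm (Fin (r + 1))} (hω : ∀ k, ∃ m : ℕ, ((finRotate (r + 1) * ω) ^ m) 0 = k)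
    (S : Fin (r + 1) ↪o Fin (N + 1)) :
    IsLongPerm (N + 1 + (ℓ + 1))
      (turn N η * extendPerm (headEmb L N) τ * tailPerm L S ω) := by
  obtain ⟨hP, hP₀, hP₁, hP₂, hrest⟩ := h
  set σ := turn N η * extendPerm (headEmb L N) τ with hσ
  have σ_head : ∀ a, τ a ≠ Fin.last L → σ (headEmb L N a) = headEmb L N (η (τ a + 1)) :=
    fun a ha => by rw [hσ, Perm.mul_apply, extendPerm_apply, turn_head η ha]
  have σ_head_last : ∀ a, τ a = Fin.last L → σ (headEmb L N a) = tailEmb L N 0 :=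
    fun a ha => by rw [hσ, Perm.mul_apply, extendPerm_apply, ha, turn_head_last]
  have σ_tail : ∀ j, j ≠ Fin.last N → σ (tailEmb L N j) = tailEmb L N (j + 1) :=
    fun j hj => by rw [hσ, Perm.mul_apply, extendPerm_headEmb_tail, turn_tail η hj]
  have σ_tail_last : σ (tailEmb L N (Fin.last N)) = headEmb L N (P 0) := by
    rw [hσ, Perm.mul_apply, extendPerm_headEmb_tail, turn_tail_last, hP₀]
  set e : ℕ → Fin (L + 1 + (N + 1)) := fun i => (σ ^ i) (tailEmb L N 0) with he
  have e_succ : ∀ i, e (i + 1) = σ (e i) := fun i => by simp only [he, pow_succ', Perm.mul_apply]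
  have e_tail : ∀ j : Fin (N + 1), e j = tailEmb L N j := by
    intro j
    induction j using Fin.induction with
    | zero => rfl
    | succ j ih =>
      rw [Fin.val_succ, e_succ, ← Fin.val_castSucc, ih, σ_tail _ (Fin.castSucc_lt_last j).ne,
        Fin.coeSucc_eq_succ]
  have e_path : ∀ l : Fin (ℓ + 1), e (N + 1 + l) = headEmb L N (P l) := by
    intro l
    induction l using Fin.induction with
    | zero =>
      have := e_tail (Fin.last N)
      rw [Fin.val_last] at this
      rw [Fin.val_zero, add_zero, e_succ, this, σ_tail_last]
    | succ l ih =>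
      rw [Fin.val_succ, ← add_assoc (N + 1), e_succ, ← Fin.val_castSucc l, ih, σ_head _ (hP₁ l).1,
        (hP₁ l).2]
  have e_last : e (N + 1 + (ℓ + 1)) = e 0 := by
    have := e_path (Fin.last ℓ)
    rw [Fin.val_last] at this
    rw [← add_assoc (N + 1), e_succ, this, σ_head_last _ hP₂]
    rfl
  have e_cases : ∀ i < N + 1 + (ℓ + 1),
      (∃ j : Fin (N + 1), i = j) ∨ ∃ l : Fin (ℓ + 1), i = N + 1 + l := by
    intro i hi
    rcases lt_or_ge i (N + 1) with h | h
    · exact Or.inl ⟨⟨i, h⟩, rfl⟩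
    · exact Or.inr ⟨⟨i - (N + 1), by omega⟩, by simp; omega⟩
  have hcyc : (σ * tailPerm L S ω).IsCycleOn
      ((Finset.range (N + 1 + (ℓ + 1))).image e : Finset (Fin (L + 1 + (N + 1)))) := by
    refine isCycleOn_mul_of_arcs (g := fun k => (S k : ℕ)) (fun i _ => (e_succ i).symm) e_last
      (fun a b hab => S.strictMono hab) (fun k => by omega) hω (fun k => ?_) fun i hi hk => ?_
    · rw [e_tail, e_tail, tailPerm_selected]
    · rcases e_cases i hi with ⟨j, rfl⟩ | ⟨l, rfl⟩
      · rw [e_tail, tailPerm_tail S ω fun k h => hk k (congrArg Fin.val h)]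
      · rw [e_path, tailPerm_head]
  have hinj : Set.InjOn e (Finset.range (N + 1 + (ℓ + 1))) := by
    intro i hi i' hi' h
    rw [Finset.coe_range, Set.mem_Iio] at hi hi'
    rcases e_cases i hi with ⟨j, rfl⟩ | ⟨l, rfl⟩ <;>
      rcases e_cases i' hi' with ⟨j', rfl⟩ | ⟨l', rfl⟩ <;>
      simp only [e_tail, e_path] at h
    · rw [(tailEmb L N).injective h]
    · exact absurd h.symm (headEmb_ne_tailEmb _ _)
    · exact absurd h (headEmb_ne_tailEmb _ _)
    · rw [hP ((headEmb L N).injective h)]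
  refine IsLongPerm.of_isCycleOn hcyc ⟨e 0, Finset.mem_image_of_mem e (by simp)⟩
    (by rw [Finset.card_image_of_injOn hinj, Finset.card_range]) fun i hi => ?_
  have hmem : ∀ i < N + 1 + (ℓ + 1), e i ∈ (Finset.range (N + 1 + (ℓ + 1))).image e :=
    fun i h => Finset.mem_image_of_mem e (Finset.mem_range.2 h)
  rcases head_or_tail i with ⟨a, rfl⟩ | ⟨j, rfl⟩
  · have ha : ∀ l, P l ≠ a := by
      rintro l rfl
      rw [← e_path] at hi
      exact hi (hmem _ (by omega))
    obtain ⟨h₁, h₂, h₃⟩ := hrest a ha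
    have z₁ : (σ * tailPerm L S ω) (headEmb L N a) = headEmb L N (η (τ a + 1)) := by
      rw [Perm.mul_apply, tailPerm_head, σ_head a h₁]
    rcases hfix with hfix | ⟨m, hm⟩
    · rw [hfix a ha] at z₁
      exact Perm.pow_apply_eq_self_of_apply_eq_self z₁ _
    · rw [hm, ← two_mul, pow_mul]
      refine Perm.pow_apply_eq_self_of_apply_eq_self ?_ _
      rw [sq, Perm.mul_apply, z₁, Perm.mul_apply, tailPerm_head, σ_head _ h₂, h₃]
  · rw [← e_tail] at hi
    exact absurd (hmem _ (by omega)) hi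

open MulAction Pointwise in
theorem alternatingGroup_le_closure_turn {L N : ℕ} (hL : 1 ≤ L) {η τ : Perm (Fin (L + 1))}
    (hτ : ∀ b ≠ 0, ∃ k : ℕ, (τ ^ k) 0 = b ∧ τ ∈ Subgroup.zpowers (τ ^ k))
    {c : Perm (Fin (L + 1 + (N + 1)))} (hc : c.IsThreeCycle)
    (hcG : c ∈ Subgroup.closure {turn N η, extendPerm (headEmb L N) τ}) :
    alternatingGroup (Fin (L + 1 + (N + 1))) ≤
      Subgroup.closure {turn N η, extendPerm (headEmb L N) τ} := by
  set x := turn N η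
  set t := extendPerm (headEmb L N) τ
  set G := Subgroup.closure {x, t}
  have hx : x ∈ G := Subgroup.subset_closure (by simp)
  have ht : t ∈ G := Subgroup.subset_closure (by simp)
  have ht_pow : ∀ k : ℕ, t ^ k = extendPerm (headEmb L N) (τ ^ k) := fun k => (map_pow _ _ _).symm
  have orbit_head : ∀ b, ∃ g ∈ G, g (headEmb L N 0) = headEmb L N b := by
    intro b
    by_cases hb : b = 0
    · exact ⟨1, G.one_mem, by rw [hb, Perm.one_apply]⟩
    · obtain ⟨k, hk, -⟩ := hτ b hb
      exact ⟨t ^ k, G.pow_mem ht k, by rw [ht_pow, extendPerm_apply, hk]⟩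
  have orbit : ∀ i, ∃ g ∈ G, g (headEmb L N 0) = i := by
    intro i
    rcases head_or_tail i with ⟨b, rfl⟩ | ⟨j, rfl⟩
    · exact orbit_head b
    · induction j using Fin.induction with
      | zero =>
        obtain ⟨g, hg, h⟩ := orbit_head (Fin.last L)
        exact ⟨x * g, G.mul_mem hx hg, by rw [Perm.mul_apply, h, turn_head_last]⟩
      | succ j ih =>
        obtain ⟨g, hg, h⟩ := ih
        refine ⟨x * g, G.mul_mem hx hg, ?_⟩
        rw [Perm.mul_apply, h, turn_tail η (Fin.castSucc_lt_last j).ne, Fin.coeSucc_eq_succ]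
  have hpre : IsPretransitive G (Fin (L + 1 + (N + 1))) :=
    isPretransitive_iff_base (headEmb L N 0) |>.2 fun i =>
      let ⟨g, hg, h⟩ := orbit i
      ⟨⟨g, hg⟩, h⟩
  refine Perm.alternatingGroup_le_of_isPreprimitive_of_isThreeCycle_mem
    (IsPreprimitive.of_isTrivialBlock_base (headEmb L N 0) fun {B} haB hB => ?_) hc hcG
  rw [IsTrivialBlock, or_iff_not_imp_left]
  intro hsub
  have smul_eq : ∀ {g}, g ∈ G → ∀ {i}, i ∈ B → g i ∈ B → g • B = B := fun {g} hg {i} hi hgi =>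
    hB.smul_eq_of_mem (g := (⟨g, hg⟩ : G)) hi hgi
  have mem_of_smul : ∀ {g : Perm (Fin (L + 1 + (N + 1)))}, g • B = B → ∀ {i}, i ∈ B → g i ∈ B :=
    fun {g} hg {i} hi => hg ▸ Set.smul_mem_smul_set hi
  obtain ⟨b, hb, hne⟩ : ∃ b ∈ B, b ≠ headEmb L N 0 := by
    by_contra! h
    exact hsub fun i hi j hj => (h i hi).trans (h j hj).symm
  have htB : t • B = B := by
    rcases head_or_tail b with ⟨b, rfl⟩ | ⟨j, rfl⟩
    · obtain ⟨k, hk, hmem⟩ := hτ b fun h => hne (by rw [h])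
      have hkB : t ^ k ∈ stabilizer (Perm (Fin (L + 1 + (N + 1)))) B :=
        smul_eq (G.pow_mem ht k) haB (by rwa [ht_pow, extendPerm_apply, hk])
      have ht' : t ∈ Subgroup.zpowers (t ^ k) := by
        obtain ⟨m, hm⟩ := hmem
        refine ⟨m, ?_⟩
        simp only at hm ⊢
        rw [ht_pow, ← map_zpow, hm]
      exact (Subgroup.zpowers_le.2 hkB) ht'
    · exact smul_eq ht hb (by rwa [extendPerm_headEmb_tail])
  have head_mem : ∀ b, headEmb L N b ∈ B := by
    intro b
    by_cases hb : b = 0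
    · rwa [hb]
    · obtain ⟨k, hk, -⟩ := hτ b hb
      rw [← hk, ← extendPerm_apply, ← ht_pow]
      exact mem_of_smul ((stabilizer (Perm (Fin (L + 1 + (N + 1)))) B).pow_mem htB k) haB
  have hxB : x • B = B := by
    have h0 : (0 : Fin (L + 1)) ≠ Fin.last L := by
      intro h
      have := congrArg Fin.val h
      simp at this
      omega
    refine smul_eq hx (head_mem 0) ?_
    rw [turn_head η h0]
    exact head_mem _
  have hGB : G ≤ stabilizer (Perm (Fin (L + 1 + (N + 1)))) B := by
    rw [Subgroup.closure_le]
    rintro g (rfl | rfl)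
    · exact hxB
    · exact htB
  refine Set.eq_univ_of_forall fun i => ?_
  obtain ⟨g, hg, rfl⟩ := orbit i
  exact mem_of_smul (hGB hg) haB

theorem support_zpow_eq_of_orderOf_prime {α : Type*} [Fintype α] [DecidableEq α] {σ : Perm α}
    (hσ : (orderOf σ).Prime) {m : ℤ} (hm : σ ^ m ≠ 1) : (σ ^ m).support = σ.support := by
  refine (Perm.support_zpow_le σ m).antisymm ?_
  have hcop : IsCoprime m (orderOf σ : ℤ) := by
    refine ((Nat.prime_iff_prime_int.1 hσ).coprime_iff_not_dvd.2 fun h => hm ?_).symm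
    exact orderOf_dvd_iff_zpow_eq_one.1 h
  obtain ⟨a, b, hab⟩ := hcop
  have hpow : (σ ^ m) ^ a = σ := by
    rw [← zpow_mul, mul_comm, eq_sub_of_add_eq hab, zpow_sub, zpow_one, mul_comm b, zpow_mul,
      zpow_natCast, pow_orderOf_eq_one, one_zpow, inv_one, mul_one]
  calc σ.support = ((σ ^ m) ^ a).support := by rw [hpow]
    _ ≤ (σ ^ m).support := Perm.support_zpow_le _ _

theorem card_support_mul_zpow {α : Type*} [Fintype α] [DecidableEq α] {σ τ : Perm α}
    (hd : σ.Disjoint τ) (hσ : (orderOf σ).Prime) (hτ : (orderOf τ).Prime)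
    (hne : orderOf τ ≠ orderOf σ) {m : ℤ} (hm : (orderOf ((σ * τ) ^ m)).Prime) :
    ((σ * τ) ^ m).support.card = σ.support.card ∨
      ((σ * τ) ^ m).support.card = τ.support.card := by
  have hdm : (σ ^ m).Disjoint (τ ^ m) := hd.zpow_disjoint_zpow m m
  rw [hd.commute.mul_zpow] at hm ⊢
  have hord : ∀ {ρ : Perm α}, (orderOf ρ).Prime → ρ ^ m ≠ 1 → orderOf (ρ ^ m) = orderOf ρ :=
    fun {ρ} hρ h => ((Nat.dvd_prime hρ).1 (orderOf_dvd_of_mem_zpowers ⟨m, rfl⟩)).resolve_left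
      fun h1 => h (orderOf_eq_one_iff.1 h1)
  by_cases h₁ : σ ^ m = 1
  · rw [h₁, one_mul] at hm ⊢
    refine Or.inr (congrArg _ (support_zpow_eq_of_orderOf_prime hτ fun h => ?_))
    rw [h, orderOf_one] at hm
    exact Nat.not_prime_one hm
  · by_cases h₂ : τ ^ m = 1
    · rw [h₂, mul_one]
      exact Or.inl (congrArg _ (support_zpow_eq_of_orderOf_prime hσ h₁))
    · rw [hdm.orderOf, hord hσ h₁, hord hτ h₂] at hm
      have e₁ := (Nat.dvd_prime hm).1 (Nat.dvd_lcm_left (orderOf σ) (orderOf τ))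
      have e₂ := (Nat.dvd_prime hm).1 (Nat.dvd_lcm_right (orderOf σ) (orderOf τ))
      exact absurd ((e₂.resolve_left hτ.ne_one).trans (e₁.resolve_left hσ.ne_one).symm) hne

theorem disjoint_extendPerm_tailPerm {L N r : ℕ} (τ : Perm (Fin (L + 1)))
    (S : Fin r ↪o Fin (N + 1)) (ω : Perm (Fin r)) :
    (extendPerm (headEmb L N) τ).Disjoint (tailPerm L S ω) := by
  intro i
  rcases head_or_tail i with ⟨a, rfl⟩ | ⟨j, rfl⟩
  · exact Or.inr (tailPerm_head S ω a)
  · exact Or.inl (extendPerm_headEmb_tail τ j)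

theorem closure_mk_eq_top {G : Type*} [Group G] {H : Subgroup G} {x t : G} (hx : x ∈ H)
    (ht : t ∈ H) (h : H ≤ Subgroup.closure {x, t}) :
    Subgroup.closure {(⟨x, hx⟩ : H), ⟨t, ht⟩} = ⊤ := by
  refine eq_top_iff.2 fun g _ => ?_
  have hmap : (Subgroup.closure {(⟨x, hx⟩ : H), ⟨t, ht⟩}).map H.subtype =
      Subgroup.closure {x, t} := by
    rw [MonoidHom.map_closure, Set.image_pair]
    rfl
  obtain ⟨g', hg', hgg'⟩ := hmap ▸ h g.2
  rwa [← Subtype.ext hgg']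

theorem isTripleFamily_turn {ι : Type*} [Finite ι] {L N ℓ r e : ℕ} {η τ : Perm (Fin (L + 1))}
    {P P' : Fin (ℓ + 1) → Fin (L + 1)} (h5 : 5 ≤ L + 1 + (N + 1)) (hL : 1 ≤ L)
    (hη : IsHeadPath η 1 P)
    (hηfix : (∀ a, (∀ l, P l ≠ a) → η (a + 1) = a) ∨ Even (N + 1 + (ℓ + 1)))
    (hητ : IsHeadPath η τ P')
    (hητfix : (∀ a, (∀ l, P' l ≠ a) → η (τ a + 1) = a) ∨ Even (N + 1 + (ℓ + 1)))
    (hτ : ∀ b ≠ 0, ∃ k : ℕ, (τ ^ k) 0 = b ∧ τ ∈ Subgroup.zpowers (τ ^ k))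
    (hτ_order : (orderOf τ).Prime) (hτ_supp : τ.support.card = L + 1)
    (hτ_sign : Perm.sign τ = 1) (hη_sign : turn N η ∈ alternatingGroup (Fin (L + 1 + (N + 1))))
    (hc : ∃ c ∈ Subgroup.closure {turn N η, extendPerm (headEmb L N) τ}, c.IsThreeCycle)
    {S : ι → Fin (r + 1) ↪o Fin (N + 1)} {ω : ι → Perm (Fin (r + 1))}
    (hinj : Function.Injective fun i => tailPerm L (S i) (ω i))
    (hω : ∀ i k, ∃ m : ℕ, ((finRotate (r + 1) * ω i) ^ m) 0 = k)
    (hω_order : ∀ i, (orderOf (ω i)).Prime) (hne : ∀ i, orderOf (ω i) ≠ orderOf τ)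
    (hω_supp : ∀ i, (ω i).support.card = r + 1) (hω_sign : ∀ i, Perm.sign (ω i) = 1)
    (he : τ ^ e = τ) (heω : ∀ i, ω i ^ e = 1) :
    ∃ (x : alternatingGroup (Fin (L + 1 + (N + 1))))
      (y : ι → alternatingGroup (Fin (L + 1 + (N + 1)))),
      IsTripleFamily (N + 1 + (ℓ + 1)) (L + 1) (r + 1) x y := by
  obtain ⟨c, hcG, hc⟩ := hc
  set t := extendPerm (headEmb L N) τ
  have ht : t ∈ alternatingGroup (Fin (L + 1 + (N + 1))) := by
    rw [Perm.mem_alternatingGroup, sign_extendPerm, hτ_sign]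
  have hw : ∀ i, tailPerm L (S i) (ω i) ∈ alternatingGroup (Fin (L + 1 + (N + 1))) := fun i => by
    rw [Perm.mem_alternatingGroup, tailPerm, sign_extendPerm, hω_sign]
  have hd : ∀ i, t.Disjoint (tailPerm L (S i) (ω i)) := fun i =>
    disjoint_extendPerm_tailPerm τ (S i) (ω i)
  have ht_order : orderOf t = orderOf τ := orderOf_extendPerm _ _
  have hw_order : ∀ i, orderOf (tailPerm L (S i) (ω i)) = orderOf (ω i) := fun i =>
    orderOf_extendPerm _ _
  let x : alternatingGroup (Fin (L + 1 + (N + 1))) := ⟨turn N η, hη_sign⟩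
  let y : ι → alternatingGroup (Fin (L + 1 + (N + 1))) := fun i =>
    ⟨t * tailPerm L (S i) (ω i), Subgroup.mul_mem _ ht (hw i)⟩
  have hy : Function.Injective y := fun i j hij =>
    hinj (mul_left_cancel (congrArg Subtype.val hij))
  have hcard : 5 ≤ Nat.card (Fin (L + 1 + (N + 1))) := by rwa [Nat.card_fin]
  have hsimple : IsSimpleGroup (alternatingGroup (Fin (L + 1 + (N + 1)))) :=
    alternatingGroup.isSimpleGroup hcard
  refine ⟨x, y, ?_, ?_, fun i => ?_, fun i => ?_, fun i m hm => ?_⟩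
  · refine pi_eq_top_of_const_mem (commutator_alternatingGroup_eq_top hcard) (x := x)
      (t := ⟨t, ht⟩) hy (e := e) (fun i => Subtype.ext ?_)
      (closure_mk_eq_top hη_sign ht (alternatingGroup_le_closure_turn hL hτ hc hcG))
      (Subgroup.subset_closure (by simp)) (Subgroup.subset_closure (by simp))
    change (t * tailPerm L (S i) (ω i)) ^ e = t
    rw [(hd i).commute.mul_pow, tailPerm, ← map_pow, ← map_pow, he, heω, map_one, mul_one]
  · have hlong := hη.isLongPerm (N := N) (r := 0) (ω := 1) hηfix
      (fun k => ⟨0, Subsingleton.elim (α := Fin 1) _ _⟩)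
      (Fin.castLEOrderEmb (by omega))
    rwa [tailPerm, map_one, map_one, mul_one, mul_one] at hlong
  · have hlong := hητ.isLongPerm hητfix (hω i) (S i)
    rwa [mul_assoc] at hlong
  · rw [← Subgroup.orderOf_coe]
    change 4 ≤ orderOf (t * tailPerm L (S i) (ω i))
    rw [(hd i).orderOf, ht_order, hw_order, ((Nat.coprime_primes hτ_order (hω_order i)).2
      (hne i).symm).lcm_eq_mul]
    exact Nat.mul_le_mul hτ_order.two_le (hω_order i).two_le
  · have := card_support_mul_zpow (hd i) (by rwa [ht_order]) (by rw [hw_order]; exact hω_order i)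
      (by rw [ht_order, hw_order]; exact hne i) hm
    rwa [card_support_extendPerm, hτ_supp, tailPerm, card_support_extendPerm, hω_supp] at this

section Selection

variable {L N r : ℕ}

theorem tailPerm_inj {S S' : Fin r ↪o Fin (N + 1)} {ω ω' : Perm (Fin r)}
    (hω : ∀ k, ω k ≠ k) (hω' : ∀ k, ω' k ≠ k) (h : tailPerm L S ω = tailPerm L S' ω') :
    S = S' ∧ ω = ω' := by
  have range_le : ∀ {S S' : Fin r ↪o Fin (N + 1)} {ω ω' : Perm (Fin r)}, (∀ k, ω k ≠ k) →
      tailPerm L S ω = tailPerm L S' ω' → Set.range S ⊆ Set.range S' := by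
    rintro S S' ω ω' hω h _ ⟨k, rfl⟩
    by_contra hk
    have h₁ := tailPerm_selected (L := L) S ω k
    rw [h, tailPerm_tail S' ω' fun l hl => hk ⟨l, hl⟩] at h₁
    exact hω k (S.injective ((tailEmb L N).injective h₁)).symm
  obtain rfl : S = S' :=
    OrderEmbedding.range_inj.1 ((range_le hω h).antisymm (range_le hω' h.symm))
  exact ⟨rfl, extendPerm_injective _ h⟩

theorem exists_injective_tailPerm {q k : ℕ} (W : Fin q → Perm (Fin r))
    (hW : Function.Injective W) (hfix : ∀ j a, W j a ≠ a) (hk : k ≤ (N + 1).choose r * q) :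
    ∃ (S : Fin k → Fin r ↪o Fin (N + 1)) (j : Fin k → Fin q),
      Function.Injective fun i => tailPerm L (S i) (W (j i)) := by
  have hcard : Fintype.card (Fin k) ≤
      Fintype.card ({s : Finset (Fin (N + 1)) // s.card = r} × Fin q) := by
    rwa [Fintype.card_prod, Fintype.card_finset_len, Fintype.card_fin, Fintype.card_fin,
      Fintype.card_fin]
  obtain ⟨f⟩ := Function.Embedding.nonempty_of_card_le hcard
  refine ⟨fun i => (f i).1.1.orderEmbOfFin (f i).1.2, fun i => (f i).2, fun i i' h => ?_⟩
  obtain ⟨hS, hj⟩ := tailPerm_inj (hfix _) (hfix _) h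
  refine f.injective (Prod.ext (Subtype.ext (Finset.coe_injective ?_)) (hW hj))
  rw [← Finset.range_orderEmbOfFin _ (f i).1.2, ← Finset.range_orderEmbOfFin _ (f i').1.2]
  exact congrArg (fun S : Fin r ↪o Fin (N + 1) => Set.range S) hS

end Selection

section ThreeCycle

variable {L N m : ℕ} (η : Perm (Fin (L + 1)))

/-- The embedding of an initial segment containing the head. -/
abbrev initEmb (L : ℕ) {m N : ℕ} (h : m ≤ N) : Fin (L + 1 + (m + 1)) ↪ Fin (L + 1 + (N + 1)) :=
  Fin.castLEEmb (by omega)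

theorem turn_initEmb (h : m ≤ N) {i : Fin (L + 1 + (m + 1))} (hi : i ≠ Fin.last (L + 1 + m)) :
    turn N η (initEmb L h i) = initEmb L h (turn m η i) := by
  rcases head_or_tail i with ⟨a, rfl⟩ | ⟨j, rfl⟩
  · by_cases ha : a = Fin.last L
    · subst ha
      rw [turn_head_last]
      exact turn_head_last η
    · rw [turn_head η ha]
      exact turn_head (N := N) η ha
  · have hj : j ≠ Fin.last m := by
      rintro rfl
      exact hi (by ext; simp)
    have hlt := Fin.lt_last_iff_ne_last.2 hj
    rw [Fin.lt_def, Fin.val_last] at hlt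
    have hval : ∀ (j : Fin (m + 1)), initEmb L h (tailEmb L m j) =
        tailEmb L N (Fin.castLE (by omega) j) := fun j => by ext; simp
    rw [turn_tail η hj, hval, hval, turn_tail]
    · congr 1
      ext
      rw [Fin.val_add_one_of_lt (Fin.lt_last_iff_ne_last.2 _), Fin.val_castLE, Fin.val_castLE,
        Fin.val_add_one_of_lt (Fin.lt_last_iff_ne_last.2 hj)]
      exact fun hl => by simpa using hlt.trans_le h |>.ne (by simpa using congrArg Fin.val hl)
    · exact fun hl => (hlt.trans_le h).ne (by simpa using congrArg Fin.val hl)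

theorem turn_conj_extendPerm (h : m ≤ N) {π : Perm (Fin (L + 1 + (m + 1)))}
    (hπ : π (Fin.last (L + 1 + m)) = Fin.last (L + 1 + m)) :
    turn N η * extendPerm (initEmb L h) π * (turn N η)⁻¹ =
      extendPerm (initEmb L h) (turn m η * π * (turn m η)⁻¹) := by
  have hπ' : ∀ {i}, i ≠ Fin.last (L + 1 + m) → π i ≠ Fin.last (L + 1 + m) := fun hi hl =>
    hi (π.injective (hl.trans hπ.symm))
  rw [mul_inv_eq_iff_eq_mul]
  ext1 i
  rw [Perm.mul_apply, Perm.mul_apply]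
  by_cases hi : ∃ a ≠ Fin.last (L + 1 + m), initEmb L h a = i
  · obtain ⟨a, ha, rfl⟩ := hi
    rw [extendPerm_apply, turn_initEmb η h (hπ' ha), turn_initEmb η h ha, extendPerm_apply]
    simp
  · have fix_left : extendPerm (initEmb L h) π i = i := by
      by_cases hl : initEmb L h (Fin.last (L + 1 + m)) = i
      · rw [← hl, extendPerm_apply, hπ]
      · refine extendPerm_apply_of_notMem _ _ fun a ha => ?_
        by_cases hal : a = Fin.last (L + 1 + m)
        · exact hl (hal ▸ ha)
        · exact hi ⟨a, hal, ha⟩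
    rw [fix_left]
    by_cases hb : ∃ b, initEmb L h b = turn N η i
    · obtain ⟨b, hb⟩ := hb
      obtain ⟨a, rfl⟩ := (turn m η).surjective b
      have ha : a = Fin.last (L + 1 + m) := by
        by_contra ha
        rw [← turn_initEmb η h ha] at hb
        exact hi ⟨a, ha, (turn N η).injective hb⟩
      rw [← hb, extendPerm_apply]
      simp [ha, hπ]
    · rw [extendPerm_apply_of_notMem]
      exact fun b hb' => hb ⟨b, hb'⟩

theorem extendPerm_initEmb_headEmb (h : m ≤ N) (τ : Perm (Fin (L + 1))) :
    extendPerm (initEmb L h) (extendPerm (headEmb L m) τ) = extendPerm (headEmb L N) τ := by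
  ext1 i
  by_cases hi : ∃ a, initEmb L h a = i
  · obtain ⟨a, rfl⟩ := hi
    rw [extendPerm_apply]
    rcases head_or_tail a with ⟨b, rfl⟩ | ⟨j, rfl⟩
    · rw [extendPerm_apply]
      exact (extendPerm_apply (headEmb L N) τ b).symm
    · rw [extendPerm_headEmb_tail, extendPerm_apply_of_notMem]
      intro b hb
      have := congrArg Fin.val hb
      simp at this
      omega
  · rw [extendPerm_apply_of_notMem _ _ fun a ha => hi ⟨a, ha⟩, extendPerm_apply_of_notMem]
    exact fun b hb => hi ⟨headEmb L m b, hb⟩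

end ThreeCycle

section Families

/-- The permutation given by a function whose third power is the identity. -/
def permOfCube {n : ℕ} (f : Fin n → Fin n) (h : ∀ i, f (f (f i)) = i) : Perm (Fin n) :=
  ⟨f, fun i => f (f i), h, h⟩

/-- Eight permutations of cycle type `3 + 3` whose product with the rotation is a six-cycle. -/
def sixPattern (j : Fin 8) : Perm (Fin 6) :=
  permOfCube (![![1, 2, 0, 4, 5, 3], ![1, 3, 4, 0, 5, 2], ![1, 4, 3, 5, 0, 2],
    ![1, 5, 3, 4, 2, 0], ![2, 3, 5, 4, 1, 0], ![2, 4, 3, 0, 5, 1], ![2, 5, 4, 1, 0, 3],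
    ![3, 2, 4, 5, 1, 0]] j) (by revert j; decide)

/-- Two seven-cycles whose product with the rotation is a seven-cycle. -/
def sevenPattern (j : Fin 2) : Perm (Fin 7) :=
  finRotate 7 ^ ((j : ℕ) + 1)

theorem sixPattern_injective : Function.Injective sixPattern := by
  decide +kernel

theorem sixPattern_apply_ne : ∀ j a, sixPattern j a ≠ a := by
  decide +kernel

theorem orderOf_sixPattern (j : Fin 8) : orderOf (sixPattern j) = 3 := by
  refine orderOf_eq_prime ?_ ?_ <;> revert j <;> decide +kernel

theorem finRotate_mul_sixPattern :
    ∀ j k, ∃ m : ℕ, ((finRotate 6 * sixPattern j) ^ m) 0 = k := by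
  have : ∀ j k, ∃ m : Fin 6, ((finRotate 6 * sixPattern j) ^ (m : ℕ)) 0 = k := by
    decide +kernel
  exact fun j k => (this j k).imp' _ fun m hm => hm

theorem sevenPattern_injective : Function.Injective sevenPattern := by
  decide +kernel

theorem sevenPattern_apply_ne : ∀ j a, sevenPattern j a ≠ a := by
  decide +kernel

theorem orderOf_sevenPattern (j : Fin 2) : orderOf (sevenPattern j) = 7 := by
  have : Fact (Nat.Prime 7) := ⟨by norm_num⟩
  refine orderOf_eq_prime ?_ ?_ <;> revert j <;> decide +kernel

theorem finRotate_mul_sevenPattern :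
    ∀ j k, ∃ m : ℕ, ((finRotate 7 * sevenPattern j) ^ m) 0 = k := by
  have : ∀ j k, ∃ m : Fin 7, ((finRotate 7 * sevenPattern j) ^ (m : ℕ)) 0 = k := by
    decide +kernel
  exact fun j k => (this j k).imp' _ fun m hm => hm

theorem turn_mem_alternatingGroup {L N : ℕ} {η : Perm (Fin (L + 1))}
    (h : Perm.sign η = (-1) ^ (L + 1 + N)) :
    turn N η ∈ alternatingGroup (Fin (L + 1 + (N + 1))) := by
  rw [Perm.mem_alternatingGroup, turn, map_mul, sign_extendPerm, h]
  have := sign_finRotate (L + 1 + (N + 1))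
  rw [this]
  simp [← pow_add, ← two_mul]

theorem card_support_of_forall_apply_ne {n : ℕ} {σ : Perm (Fin n)} (h : ∀ a, σ a ≠ a) :
    σ.support.card = n := by
  rw [Finset.eq_univ_of_forall fun a => Perm.mem_support.2 (h a), Finset.card_univ,
    Fintype.card_fin]

theorem exists_pow_and_mem_zpowers_pow {L p : ℕ} {τ : Perm (Fin (L + 1))}
    (h : ∀ b ≠ 0, ∃ k m : Fin p, (τ ^ (k : ℕ)) 0 = b ∧ (τ ^ (k : ℕ)) ^ (m : ℕ) = τ) :
    ∀ b ≠ 0, ∃ k : ℕ, (τ ^ k) 0 = b ∧ τ ∈ Subgroup.zpowers (τ ^ k) := by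
  intro b hb
  obtain ⟨k, m, hk, hm⟩ := h b hb
  exact ⟨k, hk, m, (zpow_natCast _ _).trans hm⟩

theorem exists_isTripleFamily_three {N k ℓ : ℕ} {η τ : Perm (Fin 3)}
    {P P' : Fin (ℓ + 1) → Fin 3} (hk : k ≤ (N + 1).choose 7 * 2)
    (hη : IsHeadPath η 1 P) (hηfix : ∀ a, (∀ l, P l ≠ a) → η (a + 1) = a)
    (hητ : IsHeadPath η τ P') (hητfix : ∀ a, (∀ l, P' l ≠ a) → η (τ a + 1) = a)
    (hτ_cycle : τ.IsThreeCycle)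
    (hτ : ∀ b ≠ 0, ∃ k m : Fin 3, (τ ^ (k : ℕ)) 0 = b ∧ (τ ^ (k : ℕ)) ^ (m : ℕ) = τ)
    (hN : 1 ≤ N) (hsign : Perm.sign η = (-1) ^ (2 + 1 + N)) :
    ∃ (x : alternatingGroup (Fin (2 + 1 + (N + 1))))
      (y : Fin k → alternatingGroup (Fin (2 + 1 + (N + 1)))),
      IsTripleFamily (N + 1 + (ℓ + 1)) 3 7 x y := by
  obtain ⟨S, j, hinj⟩ := exists_injective_tailPerm (L := 2) sevenPattern sevenPattern_injective
    sevenPattern_apply_ne hk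
  refine isTripleFamily_turn (r := 6) (e := 7) (by omega) (by omega) hη (Or.inl hηfix) hητ
    (Or.inl hητfix) (exists_pow_and_mem_zpowers_pow hτ) (by rw [hτ_cycle.orderOf]; norm_num)
    (card_support_eq_three_iff.2 hτ_cycle) hτ_cycle.sign
    (turn_mem_alternatingGroup hsign) ⟨_, Subgroup.subset_closure (Set.mem_insert_of_mem _ rfl),
      isThreeCycle_extendPerm _ hτ_cycle⟩ hinj (fun i => finRotate_mul_sevenPattern _) ?_ ?_ ?_ ?_
    ?_ ?_
  · intro i
    rw [orderOf_sevenPattern]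
    norm_num
  · intro i
    rw [orderOf_sevenPattern, hτ_cycle.orderOf]
    norm_num
  · exact fun i => card_support_of_forall_apply_ne (sevenPattern_apply_ne _)
  · have : ∀ j, Perm.sign (sevenPattern j) = 1 := by decide +kernel
    exact fun i => this _
  · have h := pow_orderOf_eq_one τ
    rw [hτ_cycle.orderOf] at h
    rw [pow_succ, pow_mul τ 3 2, h, one_pow, one_mul]
  · intro i
    rw [← orderOf_sevenPattern (j i), pow_orderOf_eq_one]

theorem exists_isTripleFamily_five {N k ℓ : ℕ} {η τ : Perm (Fin 5)}
    {P P' : Fin (ℓ + 1) → Fin 5} (hk : k ≤ (N + 1).choose 6 * 8)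
    (hη : IsHeadPath η 1 P)
    (hηfix : (∀ a, (∀ l, P l ≠ a) → η (a + 1) = a) ∨ Even (N + 1 + (ℓ + 1)))
    (hητ : IsHeadPath η τ P')
    (hητfix : (∀ a, (∀ l, P' l ≠ a) → η (τ a + 1) = a) ∨ Even (N + 1 + (ℓ + 1)))
    (hτ : ∀ b ≠ 0, ∃ k m : Fin 5, (τ ^ (k : ℕ)) 0 = b ∧ (τ ^ (k : ℕ)) ^ (m : ℕ) = τ)
    (hτ_order : orderOf τ = 5) (hτ_supp : τ.support.card = 5) (hτ_sign : Perm.sign τ = 1)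
    (hsign : Perm.sign η = (-1) ^ (4 + 1 + N))
    (hc : ∃ c ∈ Subgroup.closure {turn N η, extendPerm (headEmb 4 N) τ}, c.IsThreeCycle) :
    ∃ (x : alternatingGroup (Fin (4 + 1 + (N + 1))))
      (y : Fin k → alternatingGroup (Fin (4 + 1 + (N + 1)))),
      IsTripleFamily (N + 1 + (ℓ + 1)) 5 6 x y := by
  obtain ⟨S, j, hinj⟩ := exists_injective_tailPerm (L := 4) sixPattern sixPattern_injective
    sixPattern_apply_ne hk
  refine isTripleFamily_turn (r := 5) (e := 6) (by omega) (by omega) hη hηfix hητ hητfix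
    (exists_pow_and_mem_zpowers_pow hτ) (by rw [hτ_order]; norm_num) hτ_supp hτ_sign
    (turn_mem_alternatingGroup hsign) hc hinj (fun i => finRotate_mul_sixPattern _) ?_ ?_ ?_ ?_
    ?_ ?_
  · intro i
    rw [orderOf_sixPattern]
    norm_num
  · intro i
    rw [orderOf_sixPattern, hτ_order]
    norm_num
  · exact fun i => card_support_of_forall_apply_ne (sixPattern_apply_ne _)
  · have : ∀ j, Perm.sign (sixPattern j) = 1 := by decide +kernel
    exact fun i => this _
  · rw [pow_succ, ← hτ_order, pow_orderOf_eq_one, one_mul]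
  · intro i
    rw [show 6 = 3 * 2 from rfl, ← orderOf_sixPattern (j i), pow_mul, pow_orderOf_eq_one, one_pow]

theorem isThreeCycle_of_card_support_turn_one {N : ℕ} (hN : 1 ≤ N) {η τ : Perm (Fin 5)}
    {t u v : Perm (Fin 7)} (ht : t = extendPerm (headEmb 4 1) τ) (ht_last : t 6 = 6)
    (hu : u = turn 1 η * t * (turn 1 η)⁻¹) (hu_last : u 6 = 6)
    (hv : v = turn 1 η * u * (turn 1 η)⁻¹) :
    ∀ π ∈ Subgroup.closure {t, u, v}, π.support.card = 3 →
      ∃ c ∈ Subgroup.closure {turn N η, extendPerm (headEmb 4 N) τ}, c.IsThreeCycle := by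
  intro π hπ hcard
  refine ⟨extendPerm (initEmb 4 hN) π, ?_,
    isThreeCycle_extendPerm _ (card_support_eq_three_iff.1 hcard)⟩
  set G := Subgroup.closure {turn N η, extendPerm (headEmb 4 N) τ}
  have hx : turn N η ∈ G := Subgroup.subset_closure (by simp)
  have ht' : extendPerm (initEmb 4 hN) t ∈ G := by
    rw [ht, extendPerm_initEmb_headEmb]
    exact Subgroup.subset_closure (by simp)
  have hu' : extendPerm (initEmb 4 hN) u ∈ G := by
    rw [hu, ← turn_conj_extendPerm η hN ht_last]
    exact G.mul_mem (G.mul_mem hx ht') (G.inv_mem hx)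
  have hv' : extendPerm (initEmb 4 hN) v ∈ G := by
    rw [hv, ← turn_conj_extendPerm η hN hu_last]
    exact G.mul_mem (G.mul_mem hx hu') (G.inv_mem hx)
  have hle : Subgroup.closure {t, u, v} ≤ G.comap (extendPerm (initEmb 4 hN)) := by
    rw [Subgroup.closure_le]
    rintro _ (rfl | rfl | rfl)
    exacts [ht', hu', hv']
  exact hle hπ

theorem exists_isTripleFamily_three_of_odd {n k : ℕ} (hn : Odd n) (hn5 : 5 ≤ n)
    (hk : k ≤ (n - 3).choose 7 * 2) :
    ∃ (x : alternatingGroup (Fin n)) (y : Fin k → alternatingGroup (Fin n)),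
      IsTripleFamily n 3 7 x y := by
  obtain ⟨N, rfl⟩ : ∃ N, n = 2 + 1 + (N + 1) := ⟨n - 4, by omega⟩
  rw [Nat.add_sub_cancel_left] at hk
  have h := exists_isTripleFamily_three (ℓ := 2) (η := 1) (τ := finRotate 3) (P := ![0, 1, 2])
    (P' := ![0, 2, 1]) hk (by constructor <;> decide +kernel) (by decide +kernel)
    (by constructor <;> decide +kernel) (by decide +kernel)
    (card_support_eq_three_iff.1 (by decide +kernel)) (by decide +kernel) (by omega)
    (by rw [map_one, Even.neg_one_pow (by grind)])
  rwa [show N + 1 + (2 + 1) = 2 + 1 + (N + 1) by omega] at h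

theorem exists_isTripleFamily_three_of_even {n k : ℕ} (hn : Even n) (hn5 : 5 ≤ n)
    (hk : k ≤ (n - 3).choose 7 * 2) :
    ∃ (x : alternatingGroup (Fin n)) (y : Fin k → alternatingGroup (Fin n)),
      IsTripleFamily (n - 1) 3 7 x y := by
  obtain ⟨N, rfl⟩ : ∃ N, n = 2 + 1 + (N + 1) := ⟨n - 4, by omega⟩
  rw [Nat.add_sub_cancel_left] at hk
  have h := exists_isTripleFamily_three (ℓ := 1) (η := swap 0 1) (τ := (finRotate 3)⁻¹)
    (P := ![1, 2]) (P' := ![1, 0]) hk (by constructor <;> decide +kernel) (by decide +kernel)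
    (by constructor <;> decide +kernel) (by decide +kernel)
    (card_support_eq_three_iff.1 (by decide +kernel)) (by decide +kernel) (by omega)
    (by rw [Perm.sign_swap (by decide), Odd.neg_one_pow (by grind)])
  rwa [show N + 1 + (1 + 1) = 2 + 1 + (N + 1) - 1 by omega] at h

theorem exists_isTripleFamily_five_of_odd {n k : ℕ} (hn : Odd n) (hn7 : 7 ≤ n)
    (hk : k ≤ (n - 5).choose 6 * 8) :
    ∃ (x : alternatingGroup (Fin n)) (y : Fin k → alternatingGroup (Fin n)),
      IsTripleFamily (n - 2) 5 6 x y := by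
  obtain ⟨N, rfl⟩ : ∃ N, n = 4 + 1 + (N + 1) := ⟨n - 6, by omega⟩
  rw [Nat.add_sub_cancel_left] at hk
  have : Fact (Nat.Prime 5) := ⟨by norm_num⟩
  let η : Perm (Fin 5) := permOfCube ![2, 0, 1, 3, 4] (by decide)
  let t : Perm (Fin 7) := extendPerm (headEmb 4 1) (finRotate 5)⁻¹
  let u : Perm (Fin 7) := turn 1 η * t * (turn 1 η)⁻¹
  let v : Perm (Fin 7) := turn 1 η * u * (turn 1 η)⁻¹
  have hc := isThreeCycle_of_card_support_turn_one (N := N) (by omega) (η := η)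
    (τ := (finRotate 5)⁻¹) (t := t) (u := u) (v := v) rfl (by decide +kernel) rfl
    (by decide +kernel) rfl (t * t * v * u * v⁻¹)
    (by
      have ht : t ∈ Subgroup.closure {t, u, v} := Subgroup.subset_closure (by simp)
      have hu : u ∈ Subgroup.closure {t, u, v} := Subgroup.subset_closure (by simp)
      have hv : v ∈ Subgroup.closure {t, u, v} := Subgroup.subset_closure (by simp)
      exact mul_mem (mul_mem (mul_mem (mul_mem ht ht) hv) hu) (inv_mem hv))
    (by decide +kernel)
  have h := exists_isTripleFamily_five (ℓ := 2) (η := η) (τ := (finRotate 5)⁻¹)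
    (P := ![2, 3, 4]) (P' := ![2, 1, 0]) hk (by constructor <;> decide +kernel)
    (Or.inl (by decide +kernel)) (by constructor <;> decide +kernel) (Or.inl (by decide +kernel))
    (by decide +kernel) (orderOf_eq_prime (by decide +kernel) (by decide +kernel))
    (by decide +kernel) (by decide +kernel)
    (by rw [Even.neg_one_pow (by grind)]; decide +kernel) hc
  rwa [show N + 1 + (2 + 1) = 4 + 1 + (N + 1) - 2 by omega] at h

theorem exists_isTripleFamily_five_of_even {n k : ℕ} (hn : Even n) (hn7 : 7 ≤ n)
    (hk : k ≤ (n - 5).choose 6 * 8) :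
    ∃ (x : alternatingGroup (Fin n)) (y : Fin k → alternatingGroup (Fin n)),
      IsTripleFamily (n - 2) 5 6 x y := by
  obtain ⟨N, rfl⟩ : ∃ N, n = 4 + 1 + (N + 1) := ⟨n - 6, by omega⟩
  rw [Nat.add_sub_cancel_left] at hk
  have : Fact (Nat.Prime 5) := ⟨by norm_num⟩
  let τ : Perm (Fin 5) := ⟨![2, 3, 1, 4, 0], ![4, 2, 0, 1, 3], by decide, by decide⟩
  let t : Perm (Fin 7) := extendPerm (headEmb 4 1) τ
  let u : Perm (Fin 7) := turn 1 (swap 0 2) * t * (turn 1 (swap 0 2))⁻¹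
  let v : Perm (Fin 7) := turn 1 (swap 0 2) * u * (turn 1 (swap 0 2))⁻¹
  have hc := isThreeCycle_of_card_support_turn_one (N := N) (by omega) (η := swap 0 2)
    (τ := τ) (t := t) (u := u) (v := v) rfl (by decide +kernel) rfl
    (by decide +kernel) rfl (t * t * u * t⁻¹ * u⁻¹)
    (by
      have ht : t ∈ Subgroup.closure {t, u, v} := Subgroup.subset_closure (by simp)
      have hu : u ∈ Subgroup.closure {t, u, v} := Subgroup.subset_closure (by simp)
      exact mul_mem (mul_mem (mul_mem (mul_mem ht ht) hu) (inv_mem ht)) (inv_mem hu))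
    (by decide +kernel)
  have hEven : Even (N + 1 + (2 + 1)) := by grind
  have h := exists_isTripleFamily_five (ℓ := 2) (η := swap 0 2) (τ := τ)
    (P := ![2, 3, 4]) (P' := ![2, 0, 3]) hk (by constructor <;> decide +kernel)
    (Or.inr hEven) (by constructor <;> decide +kernel) (Or.inr hEven)
    (by decide +kernel) (orderOf_eq_prime (by decide +kernel) (by decide +kernel))
    (by decide +kernel) (by decide +kernel)
    (by rw [Perm.sign_swap (by decide), Odd.neg_one_pow (by grind)]) hc
  rwa [show N + 1 + (2 + 1) = 4 + 1 + (N + 1) - 2 by omega] at h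

end Families

theorem le_choose_seven_mul {m k : ℕ} (hk : 4 * k ≤ (m + 7) * (m + 6) * (m + 5)) :
    k ≤ (m + 9).choose 7 * 2 := by
  have h := Nat.descFactorial_eq_factorial_mul_choose (m + 9) 7
  simp only [Nat.descFactorial, Nat.factorial, Nat.reduceSubDiff] at h
  have h₁ : 630 ≤ (m + 3) * (m + 4) * (m + 8) * (m + 9) :=
    (by norm_num : 630 ≤ 3 * 4 * 8 * 9).trans (by gcongr <;> omega)
  have h₂ := Nat.mul_le_mul h₁ hk
  have h₃ : (m + 3) * (m + 4) * (m + 8) * (m + 9) * ((m + 7) * (m + 6) * (m + 5)) =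
      5040 * (m + 9).choose 7 := by
    linear_combination h
  omega

theorem le_choose_six_mul {m k : ℕ} (hk : 4 * k ≤ (m + 7) * (m + 6) * (m + 5)) :
    k ≤ (m + 7).choose 6 * 8 := by
  have h := Nat.descFactorial_eq_factorial_mul_choose (m + 7) 6
  simp only [Nat.descFactorial, Nat.factorial, Nat.reduceSubDiff] at h
  have h₁ : 23 ≤ (m + 2) * (m + 3) * (m + 4) :=
    (by norm_num : 23 ≤ 2 * 3 * 4).trans (by gcongr <;> omega)
  have h₂ := Nat.mul_le_mul h₁ hk
  have h₃ : (m + 2) * (m + 3) * (m + 4) * ((m + 7) * (m + 6) * (m + 5)) =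
      720 * (m + 7).choose 6 := by
    linear_combination h
  omega

theorem An_power_beauville_small_k (n k : ℕ) (hn : 12 ≤ n) (hk1 : 2 ≤ k)
    (hk2 : (k : ℚ) ≤ ((n : ℚ) - 5) * ((n : ℚ) - 6) * ((n : ℚ) - 7) / 4) :
    IsBeauvilleGroup (Fin k → alternatingGroup (Fin n)) := by
  have : Nonempty (Fin k) := ⟨⟨0, by omega⟩⟩
  obtain ⟨m, rfl⟩ := Nat.exists_eq_add_of_le' hn
  have hk : 4 * k ≤ (m + 7) * (m + 6) * (m + 5) := by
    have : (4 * k : ℚ) ≤ (m + 7) * (m + 6) * (m + 5) := by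
      push_cast at hk2
      linarith
    exact_mod_cast this
  have hk₁ := le_choose_seven_mul hk
  have hk₂ := le_choose_six_mul hk
  have hpr : Disjoint ({3, 7} : Finset ℕ) {5, 6} := by decide
  rcases Nat.even_or_odd (m + 12) with hm | hm
  · obtain ⟨x₁, y₁, h₁⟩ := exists_isTripleFamily_three_of_even hm (by omega) hk₁
    obtain ⟨x₂, y₂, h₂⟩ := exists_isTripleFamily_five_of_even hm (by omega) hk₂
    refine isBeauvilleGroup_of_isTripleFamily h₁ h₂ ?_ (by omega) (by omega) (by omega)
      (by omega) (by omega) (by omega) hpr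
    exact (Nat.coprime_self_add_right (n := 1) (m := m + 10)).2 (Nat.coprime_one_right _) |>.symm
  · obtain ⟨x₁, y₁, h₁⟩ := exists_isTripleFamily_three_of_odd hm (by omega) hk₁
    obtain ⟨x₂, y₂, h₂⟩ := exists_isTripleFamily_five_of_odd hm (by omega) hk₂
    refine isBeauvilleGroup_of_isTripleFamily h₁ h₂ ?_ (by omega) (by omega) (by omega)
      (by omega) (by omega) (by omega) hpr
    exact ((Nat.coprime_self_add_right (n := 2) (m := m + 10)).2
      (Nat.coprime_two_right.2 (by grind))).symm
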